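/- arXiv:2104.11346 — 2 statements merged into one kernel-verified Lean document; each statement's English description precedes it below -/
import Mathlib

section
/- There exists a constant C > 0 such that for every κ ≥ 1, every V : ℝ → ℝ which is twice continuously differentiable with V, V', V'' all bounded, and all real-valued Schwartz functions q, φ on ℝ: |∫_ℝ φ(x) · (16κ⁵ T_κ(V, q')(x) − 3 V(x) q'(x)) dx| ≤ C κ^{−2} ‖φ‖_{H¹} (‖V‖_∞ + ‖V'‖_∞ + ‖V''‖_∞) ‖q‖_{H²}. -/
open MeasureTheory

/-- Free resolvent kernel `G₀(x,y) = (2κ)⁻¹ e^{-κ|x-y|}`. -/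
noncomputable def freeKernel (κ a b : ℝ) : ℝ := (2 * κ)⁻¹ * Real.exp (-(κ * |a - b|))

/-- The kernel expression `T_κ(f,h)(x) = ⟨δ_x, R₀(κ) f R₀(κ) h R₀(κ) δ_x⟩`. -/
noncomputable def quadKernel (κ : ℝ) (f h : ℝ → ℝ) (x : ℝ) : ℝ :=
  ∫ y : ℝ, ∫ z : ℝ, freeKernel κ x y * f y * freeKernel κ y z * h z * freeKernel κ z x

/-- `H¹` norm: `‖φ‖_{H¹} = (∫ φ² + φ'²)^{1/2}`. -/
noncomputable def H1norm (φ : ℝ → ℝ) : ℝ := Real.sqrt (∫ x : ℝ, φ x ^ 2 + deriv φ x ^ 2)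

/-- `H²` norm: `‖q‖_{H²} = (∫ q² + q'² + q''²)^{1/2}`. -/
noncomputable def H2norm (q : ℝ → ℝ) : ℝ :=
  Real.sqrt (∫ x : ℝ, q x ^ 2 + deriv q x ^ 2 + iteratedDeriv 2 q x ^ 2)

/-- The `L²` norm of a real function on the line. -/
noncomputable def l2norm (f : ℝ → ℝ) : ℝ := Real.sqrt (∫ x, f x ^ 2)

theorem l2norm_nonneg (f : ℝ → ℝ) : 0 ≤ l2norm f := Real.sqrt_nonneg _

theorem l2norm_comp_add_right (f : ℝ → ℝ) (b : ℝ) : l2norm (fun x => f (x + b)) = l2norm f := by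
  unfold l2norm
  rw [integral_add_right_eq_self (fun x => f x ^ 2) b]

theorem MeasureTheory.MemLp.comp_add_const {f : ℝ → ℝ} (hf : MemLp f 2) (b : ℝ) :
    MemLp (fun x => f (x + b)) 2 :=
  hf.comp_measurePreserving (measurePreserving_add_right volume b)

theorem integral_abs_mul_abs_le_l2norm {f g : ℝ → ℝ} (hf : MemLp f 2) (hg : MemLp g 2) :
    ∫ x, |f x| * |g x| ≤ l2norm f * l2norm g := by
  have h := integral_mul_norm_le_Lp_mul_Lq (μ := volume) (f := f) (g := g)
    Real.HolderConjugate.two_two (by simpa using hf) (by simpa using hg)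
  simpa [l2norm, Real.sqrt_eq_rpow] using h

theorem integrable_mul_bounded_mul {f g B : ℝ → ℝ} {c : ℝ} (hf : MemLp f 2) (hg : MemLp g 2)
    (hB : Continuous B) (hc : ∀ x, |B x| ≤ c) : Integrable (fun x => f x * (B x * g x)) := by
  have h := (hf.integrable_mul hg).bdd_mul hB.aestronglyMeasurable (Filter.Eventually.of_forall hc)
  refine h.congr (Filter.Eventually.of_forall fun x => ?_)
  simp only [Pi.mul_apply]
  ring

theorem abs_integral_mul_bounded_mul_le {f g B : ℝ → ℝ} {c : ℝ} (hf : MemLp f 2) (hg : MemLp g 2)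
    (hB : ∀ x, |B x| ≤ c) : |∫ x, f x * (B x * g x)| ≤ c * (l2norm f * l2norm g) := by
  have hc : 0 ≤ c := (abs_nonneg _).trans (hB 0)
  have hi : Integrable (fun x => |f x| * |g x|) := by
    simpa using (hf.integrable_mul hg).abs
  calc |∫ x, f x * (B x * g x)| ≤ ∫ x, c * (|f x| * |g x|) := by
        rw [← Real.norm_eq_abs]
        refine norm_integral_le_of_norm_le (hi.const_mul c) (Filter.Eventually.of_forall fun x => ?_)
        rw [Real.norm_eq_abs, abs_mul, abs_mul, mul_left_comm]
        exact mul_le_mul_of_nonneg_right (hB x) (by positivity)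
    _ = c * ∫ x, |f x| * |g x| := integral_const_mul _ _
    _ ≤ _ := mul_le_mul_of_nonneg_left (integral_abs_mul_abs_le_l2norm hf hg) hc

theorem sq_intervalIntegral_le {g : ℝ → ℝ} (hg : Continuous g) :
    (∫ t in (0 : ℝ)..1, g t) ^ 2 ≤ ∫ t in (0 : ℝ)..1, g t ^ 2 := by
  set c := ∫ t in (0 : ℝ)..1, g t with hc
  have h0 : 0 ≤ ∫ t in (0 : ℝ)..1, (g t - c) ^ 2 :=
    intervalIntegral.integral_nonneg (by norm_num) fun t _ => sq_nonneg _
  have h1 : ∫ t in (0 : ℝ)..1, (g t - c) ^ 2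
      = (∫ t in (0 : ℝ)..1, g t ^ 2) - 2 * c * c + c ^ 2 := by
    have : ∀ t, (g t - c) ^ 2 = (g t ^ 2 - 2 * c * g t) + c ^ 2 := fun t => by ring
    simp_rw [this]
    rw [intervalIntegral.integral_add, intervalIntegral.integral_sub,
      intervalIntegral.integral_const_mul]
    · simp [← hc]
    all_goals exact Continuous.intervalIntegrable (by fun_prop) _ _
  nlinarith

theorem l2norm_translate_sub_le {f f' : ℝ → ℝ} (hd : ∀ x, HasDerivAt f (f' x) x)
    (hc : Continuous f') (hf : MemLp f 2) (hf' : MemLp f' 2) (b : ℝ) :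
    l2norm (fun x => f (x + b) - f x) ≤ |b| * l2norm f' := by
  have hsq : Integrable (fun x => f' x ^ 2) := hf'.integrable_sq
  have hdiff : MemLp (fun x => f (x + b) - f x) 2 := (hf.comp_add_const b).sub hf
  have hpt : ∀ x, (f (x + b) - f x) ^ 2 ≤ b ^ 2 * ∫ t in Set.Ioc (0 : ℝ) 1, f' (x + t * b) ^ 2 := by
    intro x
    have hFTC : ∫ t in (0 : ℝ)..1, f' (x + t * b) * b = f (x + b) - f x := by
      rw [intervalIntegral.integral_eq_sub_of_hasDerivAt (f := fun t => f (x + t * b))]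
      · simp
      · intro t _
        have h1 : HasDerivAt (fun t : ℝ => x + t * b) b t := by
          simpa using ((hasDerivAt_id t).mul_const b).const_add x
        exact (hd _).comp t h1
      · exact Continuous.intervalIntegrable (by fun_prop) _ _
    rw [← hFTC, ← intervalIntegral.integral_of_le zero_le_one,
      ← intervalIntegral.integral_const_mul]
    refine (sq_intervalIntegral_le (by fun_prop)).trans (le_of_eq ?_)
    congr 1
    ext t
    ring
  have hprod : Integrable (fun p : ℝ × ℝ => f' (p.2 + p.1 * b) ^ 2)
      ((volume.restrict (Set.Ioc (0 : ℝ) 1)).prod volume) := by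
    rw [integrable_prod_iff (Continuous.aestronglyMeasurable (by fun_prop))]
    refine ⟨Filter.Eventually.of_forall fun t => hsq.comp_add_right (t * b), ?_⟩
    have : ∀ t : ℝ, ∫ x, ‖f' (x + t * b) ^ 2‖ = ∫ x, ‖f' x ^ 2‖ := fun t =>
      integral_add_right_eq_self (fun x => ‖f' x ^ 2‖) (t * b)
    simp_rw [this]
    exact integrable_const _
  have hswap : ∫ x, ∫ t in Set.Ioc (0 : ℝ) 1, f' (x + t * b) ^ 2 = ∫ x, f' x ^ 2 := by
    rw [← integral_integral_swap (f := fun t x => f' (x + t * b) ^ 2) hprod]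
    have : ∀ t : ℝ, ∫ x, f' (x + t * b) ^ 2 = ∫ x, f' x ^ 2 := fun t =>
      integral_add_right_eq_self (fun x => f' x ^ 2) (t * b)
    simp_rw [this]
    simp
  have hle : ∫ x, (f (x + b) - f x) ^ 2 ≤ b ^ 2 * ∫ x, f' x ^ 2 := by
    rw [← hswap, ← integral_const_mul]
    exact integral_mono hdiff.integrable_sq (hprod.integral_prod_right.const_mul _) hpt
  unfold l2norm
  rw [← Real.sqrt_sq_eq_abs, ← Real.sqrt_mul (sq_nonneg b)]
  exact Real.sqrt_le_sqrt hle

theorem abs_taylor_one_le {V V' V'' : ℝ → ℝ} {M : ℝ} (hV : ∀ x, HasDerivAt V (V' x) x)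
    (hV' : ∀ x, HasDerivAt V' (V'' x) x) (hM : ∀ x, |V'' x| ≤ M) (x a : ℝ) :
    |V (x + a) - V x - a * V' x| ≤ M * a ^ 2 := by
  have hM0 : 0 ≤ M := (abs_nonneg _).trans (hM 0)
  have hlip : ∀ t, |V' (x + t) - V' x| ≤ M * |t| := fun t => by
    simpa using Convex.norm_image_sub_le_of_norm_hasDerivWithin_le (f := V') (s := Set.univ)
      (fun y _ => (hV' y).hasDerivWithinAt) (fun y _ => hM y) convex_univ
      (Set.mem_univ x) (Set.mem_univ (x + t))
  have hR : ∀ t, HasDerivAt (fun t => V (x + t) - t * V' x) (V' (x + t) - V' x) t := fun t => by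
    have h1 : HasDerivAt (fun t => V (x + t)) (V' (x + t)) t := (hV (x + t)).comp_const_add x t
    simpa using! h1.sub ((hasDerivAt_id t).mul_const (V' x))
  have := Convex.norm_image_sub_le_of_norm_hasDerivWithin_le (C := M * |a|)
    (f := fun t => V (x + t) - t * V' x) (s := Set.uIcc 0 a)
      (fun y _ => (hR y).hasDerivWithinAt) (fun y hy => (hlip y).trans
        (mul_le_mul_of_nonneg_left (by simpa using Set.abs_sub_left_of_mem_uIcc hy) hM0))
      (convex_uIcc 0 a) Set.left_mem_uIcc Set.right_mem_uIcc
  rw [← sq_abs, pow_two, ← mul_assoc]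
  convert this using 1
  · rw [Real.norm_eq_abs]; congr 1; simp; ring
  · simp

theorem SchwartzMap.memLp_deriv_two (f : SchwartzMap ℝ ℝ) : MemLp (deriv f) 2 :=
  (SchwartzMap.derivCLM ℝ ℝ f).memLp 2 volume

theorem SchwartzMap.continuous_deriv (f : SchwartzMap ℝ ℝ) : Continuous (deriv f) :=
  (SchwartzMap.derivCLM ℝ ℝ f).continuous

theorem SchwartzMap.l2norm_translate_sub_le (f : SchwartzMap ℝ ℝ) (b : ℝ) :
    l2norm (fun x => f (x + b) - f x) ≤ |b| * l2norm (deriv f) :=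
  _root_.l2norm_translate_sub_le f.hasDerivAt f.continuous_deriv (f.memLp 2) f.memLp_deriv_two b

/-- A second difference of `h`, tested against `φ * V`, after one summation by parts. -/
theorem abs_integral_second_difference_le {V V' : ℝ → ℝ} {M₀ M₁ : ℝ}
    (hV : ∀ x, HasDerivAt V (V' x) x) (hM₀ : ∀ x, |V x| ≤ M₀) (hM₁ : ∀ x, |V' x| ≤ M₁)
    (φ h : SchwartzMap ℝ ℝ) (b : ℝ) :
    |(∫ x, φ x * (V x * (h (x + b) - h x))) + ∫ x, φ x * (V x * (h (x + -b) - h x))|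
      ≤ b ^ 2 * (M₀ * l2norm (deriv φ) + M₁ * l2norm φ) * l2norm (deriv h) := by
  have hVc : Continuous V := continuous_iff_continuousAt.2 fun x => (hV x).continuousAt
  have h0 : 0 ≤ M₀ := (abs_nonneg _).trans (hM₀ 0)
  have h1 : 0 ≤ M₁ := (abs_nonneg _).trans (hM₁ 0)
  have hφ := φ.memLp 2
  have hh := h.memLp 2
  have hΔφ : MemLp (fun x => φ (x + b) - φ x) 2 := (hφ.comp_add_const b).sub hφ
  have hΔh : MemLp (fun x => h (x + b) - h x) 2 := (hh.comp_add_const b).sub hh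
  have hlip : ∀ x, |V (x + b) - V x| ≤ M₁ * |b| := fun x => by
    simpa using Convex.norm_image_sub_le_of_norm_hasDerivWithin_le (f := V) (s := Set.univ)
      (fun y _ => (hV y).hasDerivWithinAt) (fun y _ => hM₁ y) convex_univ
      (Set.mem_univ x) (Set.mem_univ (x + b))
  have hshift : ∫ x, φ x * (V x * (h (x + -b) - h x))
      = ∫ x, φ (x + b) * (V (x + b) * (h x - h (x + b))) := by
    rw [← integral_add_right_eq_self (fun x => φ x * (V x * (h (x + -b) - h x))) b]
    simp
  have hVb : Continuous fun x => V (x + b) := by fun_prop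
  have hA : Integrable fun x => φ x * (V x * (h (x + b) - h x)) :=
    integrable_mul_bounded_mul hφ hΔh hVc hM₀
  have hB : Integrable fun x => φ (x + b) * (V (x + b) * (h x - h (x + b))) :=
    integrable_mul_bounded_mul (hφ.comp_add_const b) (hh.sub (hh.comp_add_const b)) hVb
      fun x => hM₀ _
  have hC : Integrable fun x => (φ (x + b) - φ x) * (V (x + b) * (h (x + b) - h x)) :=
    integrable_mul_bounded_mul hΔφ hΔh hVb fun x => hM₀ _
  have hD : Integrable fun x => φ x * ((V (x + b) - V x) * (h (x + b) - h x)) :=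
    integrable_mul_bounded_mul hφ hΔh (hVb.sub hVc) hlip
  have hsum : (∫ x, φ x * (V x * (h (x + b) - h x)))
        + ∫ x, φ (x + b) * (V (x + b) * (h x - h (x + b)))
      = -(∫ x, (φ (x + b) - φ x) * (V (x + b) * (h (x + b) - h x)))
        - ∫ x, φ x * ((V (x + b) - V x) * (h (x + b) - h x)) := by
    rw [← integral_add hA hB, ← integral_neg]
    refine Eq.trans ?_ (integral_sub hC.neg hD)
    congr 1
    ext x
    ring
  have hCb : |∫ x, (φ (x + b) - φ x) * (V (x + b) * (h (x + b) - h x))|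
      ≤ M₀ * ((|b| * l2norm (deriv φ)) * (|b| * l2norm (deriv h))) := by
    have e₁ := φ.l2norm_translate_sub_le b
    exact (abs_integral_mul_bounded_mul_le hΔφ hΔh fun x => hM₀ _).trans
      (mul_le_mul_of_nonneg_left (mul_le_mul e₁ (h.l2norm_translate_sub_le b) (l2norm_nonneg _)
        ((l2norm_nonneg _).trans e₁)) h0)
  have hDb : |∫ x, φ x * ((V (x + b) - V x) * (h (x + b) - h x))|
      ≤ (M₁ * |b|) * (l2norm φ * (|b| * l2norm (deriv h))) := by
    exact (abs_integral_mul_bounded_mul_le hφ hΔh hlip).trans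
      (mul_le_mul_of_nonneg_left (mul_le_mul_of_nonneg_left (h.l2norm_translate_sub_le b)
        (l2norm_nonneg _)) (by positivity))
  rw [hshift, hsum]
  refine (abs_sub _ _).trans ?_
  rw [abs_neg, ← sq_abs b]
  linarith

/-- The increment of `V * h` under the two shifts `a` and `b`, tested against `φ`. -/
noncomputable def pairedIncrement (φ V h : ℝ → ℝ) (a b : ℝ) : ℝ :=
  ∫ x, φ x * (V (x + a) * h (x + b) - V x * h x)

theorem pairedIncrement_eq {V V' V'' : ℝ → ℝ} {M₀ M₁ M₂ : ℝ}
    (hV : ∀ x, HasDerivAt V (V' x) x) (hV' : ∀ x, HasDerivAt V' (V'' x) x)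
    (hM₀ : ∀ x, |V x| ≤ M₀) (hM₁ : ∀ x, |V' x| ≤ M₁) (hM₂ : ∀ x, |V'' x| ≤ M₂)
    (φ h : SchwartzMap ℝ ℝ) (a b : ℝ) :
    pairedIncrement φ V h a b
      = (∫ x, φ x * ((V (x + a) - V x - a * V' x) * h (x + b)))
        + a * (∫ x, φ x * (V' x * (h (x + b) - h x)))
        + a * (∫ x, φ x * (V' x * h x)) + ∫ x, φ x * (V x * (h (x + b) - h x)) := by
  have hVc : Continuous V := continuous_iff_continuousAt.2 fun x => (hV x).continuousAt
  have hVc' : Continuous V' := continuous_iff_continuousAt.2 fun x => (hV' x).continuousAt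
  have hφ := φ.memLp 2
  have hh := h.memLp 2
  have hΔh : MemLp (fun x => h (x + b) - h x) 2 := (hh.comp_add_const b).sub hh
  have h1 : Integrable fun x => φ x * ((V (x + a) - V x - a * V' x) * h (x + b)) :=
    integrable_mul_bounded_mul hφ (hh.comp_add_const b) (by fun_prop)
      fun x => abs_taylor_one_le hV hV' hM₂ x a
  have h2 : Integrable fun x => φ x * (V' x * (h (x + b) - h x)) :=
    integrable_mul_bounded_mul hφ hΔh hVc' hM₁
  have h3 : Integrable fun x => φ x * (V' x * h x) := integrable_mul_bounded_mul hφ hh hVc' hM₁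
  have h4 : Integrable fun x => φ x * (V x * (h (x + b) - h x)) :=
    integrable_mul_bounded_mul hφ hΔh hVc hM₀
  unfold pairedIncrement
  have e₁ := integral_add ((h1.add (h2.const_mul a)).add (h3.const_mul a)) h4
  have e₂ := integral_add (h1.add (h2.const_mul a)) (h3.const_mul a)
  have e₃ := integral_add h1 (h2.const_mul a)
  simp only [Pi.add_apply] at e₁ e₂ e₃
  rw [← integral_const_mul, ← integral_const_mul, ← e₃, ← e₂, ← e₁]
  congr 1
  ext x
  ring

theorem abs_pairedIncrement_add_neg_le {V V' V'' : ℝ → ℝ} {M₀ M₁ M₂ Φ H : ℝ}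
    (hV : ∀ x, HasDerivAt V (V' x) x) (hV' : ∀ x, HasDerivAt V' (V'' x) x)
    (hM₀ : ∀ x, |V x| ≤ M₀) (hM₁ : ∀ x, |V' x| ≤ M₁) (hM₂ : ∀ x, |V'' x| ≤ M₂)
    (φ h : SchwartzMap ℝ ℝ) (hφ₀ : l2norm φ ≤ Φ) (hφ₁ : l2norm (deriv φ) ≤ Φ)
    (hh₀ : l2norm h ≤ H) (hh₁ : l2norm (deriv h) ≤ H) (a b : ℝ) :
    |pairedIncrement φ V h a b + pairedIncrement φ V h (-a) (-b)|
      ≤ (2 * a ^ 2 + 2 * (|a| * |b|) + b ^ 2) * (Φ * (M₀ + M₁ + M₂) * H) := by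
  have h0 : 0 ≤ M₀ := (abs_nonneg _).trans (hM₀ 0)
  have h1 : 0 ≤ M₁ := (abs_nonneg _).trans (hM₁ 0)
  have h2 : 0 ≤ M₂ := (abs_nonneg _).trans (hM₂ 0)
  have hΦ : 0 ≤ Φ := (l2norm_nonneg _).trans hφ₀
  have hH : 0 ≤ H := (l2norm_nonneg _).trans hh₀
  have hφ := φ.memLp 2
  have hh := h.memLp 2
  have hT : ∀ a b : ℝ, |∫ x, φ x * ((V (x + a) - V x - a * V' x) * h (x + b))|
      ≤ M₂ * a ^ 2 * (Φ * H) := fun a b => by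
    refine (abs_integral_mul_bounded_mul_le hφ (hh.comp_add_const b)
      fun x => abs_taylor_one_le hV hV' hM₂ x a).trans ?_
    rw [l2norm_comp_add_right h b]
    exact mul_le_mul_of_nonneg_left (mul_le_mul hφ₀ hh₀ (l2norm_nonneg _) hΦ) (by positivity)
  have hS : ∀ b : ℝ, |∫ x, φ x * (V' x * (h (x + b) - h x))| ≤ M₁ * (Φ * (|b| * H)) := fun b => by
    have hΔ : l2norm (fun x => h (x + b) - h x) ≤ |b| * H :=
      (h.l2norm_translate_sub_le b).trans (by gcongr)
    exact (abs_integral_mul_bounded_mul_le hφ ((hh.comp_add_const b).sub hh) hM₁).trans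
      (mul_le_mul_of_nonneg_left (mul_le_mul hφ₀ hΔ (l2norm_nonneg _) hΦ) h1)
  have hQ : b ^ 2 * (M₀ * l2norm (deriv φ) + M₁ * l2norm φ) * l2norm (deriv h)
      ≤ b ^ 2 * (M₀ * Φ + M₁ * Φ) * H := by
    have := l2norm_nonneg (deriv h)
    gcongr
  have hR := (abs_integral_second_difference_le hV hM₀ hM₁ φ h b).trans hQ
  rw [pairedIncrement_eq hV hV' hM₀ hM₁ hM₂, pairedIncrement_eq hV hV' hM₀ hM₁ hM₂]
  have hT₁ := hT a b
  have hT₂ := hT (-a) (-b)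
  have hS₁ : |a * ∫ x, φ x * (V' x * (h (x + b) - h x))| ≤ |a| * (M₁ * (Φ * (|b| * H))) := by
    rw [abs_mul]
    exact mul_le_mul_of_nonneg_left (hS b) (abs_nonneg a)
  have hS₂ : |(-a) * ∫ x, φ x * (V' x * (h (x + -b) - h x))|
      ≤ |a| * (M₁ * (Φ * (|b| * H))) := by
    rw [abs_mul, abs_neg, ← abs_neg b]
    exact mul_le_mul_of_nonneg_left (hS (-b)) (abs_nonneg a)
  rw [neg_sq] at hT₂
  have e1 : 0 ≤ a ^ 2 * (Φ * H) := by positivity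
  have e2 : 0 ≤ |a| * |b| * (Φ * H) := by positivity
  have e3 : 0 ≤ b ^ 2 * (Φ * H) := by positivity
  have k1 := mul_nonneg (add_nonneg h0 h1) e1
  have k2 := mul_nonneg (add_nonneg h0 h2) e2
  have k3 := mul_nonneg h2 e3
  rw [abs_le] at hT₁ hT₂ hS₁ hS₂ hR ⊢
  constructor <;> nlinarith

/-- The rescaled kernel `e^{-|u| - |u - v| - |v|}`. -/
noncomputable def triangleWeight (p : ℝ × ℝ) : ℝ :=
  Real.exp (-(|p.1| + |p.1 - p.2| + |p.2|))

theorem triangleWeight_nonneg (p : ℝ × ℝ) : 0 ≤ triangleWeight p := (Real.exp_pos _).le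

theorem triangleWeight_neg (p : ℝ × ℝ) : triangleWeight (-p) = triangleWeight p := by
  have h : |-p.1 - -p.2| = |p.1 - p.2| := by rw [← abs_neg]; congr 1; ring
  simp only [triangleWeight, Prod.fst_neg, Prod.snd_neg, abs_neg, h]

theorem continuous_triangleWeight : Continuous triangleWeight := by
  unfold triangleWeight
  fun_prop

theorem integrable_exp_neg_mul_abs {c : ℝ} (hc : 0 < c) :
    Integrable fun x : ℝ => Real.exp (-(c * |x|)) := by
  rw [← integrableOn_univ, ← Set.Iic_union_Ioi (a := (0 : ℝ))]
  refine IntegrableOn.union ?_ ?_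
  · refine (integrableOn_exp_mul_Iic hc 0).congr_fun (fun x hx => ?_) measurableSet_Iic
    simp only [abs_of_nonpos (Set.mem_Iic.1 hx)]
    ring_nf
  · refine (integrableOn_exp_mul_Ioi (neg_lt_zero.2 hc) 0).congr_fun (fun x hx => ?_)
      measurableSet_Ioi
    simp only [abs_of_pos (Set.mem_Ioi.1 hx)]
    ring_nf

theorem integrable_exp_neg_mul_abs_prod {c : ℝ} (hc : 0 < c) :
    Integrable fun p : ℝ × ℝ => Real.exp (-(c * (|p.1| + |p.2|))) := by
  refine ((integrable_exp_neg_mul_abs hc).mul_prod (integrable_exp_neg_mul_abs hc)).congr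
    (Filter.Eventually.of_forall fun p => ?_)
  simp only [← Real.exp_add]
  ring_nf

theorem integrable_triangleWeight : Integrable triangleWeight := by
  refine (integrable_exp_neg_mul_abs_prod one_pos).mono'
    continuous_triangleWeight.aestronglyMeasurable (Filter.Eventually.of_forall fun p => ?_)
  rw [Real.norm_of_nonneg (triangleWeight_nonneg p)]
  refine Real.exp_le_exp.2 ?_
  linarith [abs_nonneg (p.1 - p.2)]

theorem integrable_triangleWeight_mul_quadratic : Integrable fun p : ℝ × ℝ =>
    triangleWeight p * (2 * p.1 ^ 2 + 2 * (|p.1| * |p.2|) + p.2 ^ 2) := by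
  have hw := continuous_triangleWeight
  refine ((integrable_exp_neg_mul_abs_prod one_half_pos).const_mul 16).mono'
    (Continuous.aestronglyMeasurable (by fun_prop)) (Filter.Eventually.of_forall fun p => ?_)
  rw [Real.norm_of_nonneg (mul_nonneg (triangleWeight_nonneg p) (by positivity))]
  set s := |p.1| + |p.2| with hs
  have hs0 : 0 ≤ s := by positivity
  have h1 : triangleWeight p ≤ Real.exp (-s) :=
    Real.exp_le_exp.2 (by linarith [abs_nonneg (p.1 - p.2)])
  have h2 : 2 * p.1 ^ 2 + 2 * (|p.1| * |p.2|) + p.2 ^ 2 ≤ 2 * s ^ 2 := by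
    rw [hs, ← sq_abs p.1, ← sq_abs p.2]
    nlinarith [abs_nonneg p.1, abs_nonneg p.2, mul_nonneg (abs_nonneg p.1) (abs_nonneg p.2),
      sq_nonneg |p.2|]
  have h3 : 2 * s ^ 2 ≤ 16 * Real.exp (1 / 2 * s) := by
    have := Real.quadratic_le_exp_of_nonneg (x := 1 / 2 * s) (by positivity)
    nlinarith
  calc _ ≤ Real.exp (-s) * (16 * Real.exp (1 / 2 * s)) :=
        mul_le_mul h1 (h2.trans h3) (by positivity) (Real.exp_pos _).le
    _ = 16 * Real.exp (-(1 / 2 * s)) := by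
        rw [mul_left_comm, ← Real.exp_add]
        ring_nf

theorem integral_exp_neg_abs_sub_add_abs_of_nonneg {u : ℝ} (hu : 0 ≤ u) :
    ∫ v, Real.exp (-(|u - v| + |v|)) = (1 + u) * Real.exp (-u) := by
  have e1 : Set.EqOn (fun v => Real.exp (-(|u - v| + |v|)))
      (fun v => Real.exp (-u) * Real.exp (2 * v)) (Set.Iic 0) := fun v hv => by
    have hv : v ≤ 0 := hv
    simp only [← Real.exp_add, abs_of_nonpos hv, abs_of_nonneg (show 0 ≤ u - v by linarith)]
    ring_nf
  have e2 : Set.EqOn (fun v => Real.exp (-(|u - v| + |v|)))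
      (fun _ => Real.exp (-u)) (Set.uIcc 0 u) := fun v hv => by
    rw [Set.uIcc_of_le hu] at hv
    simp only [abs_of_nonneg hv.1, abs_of_nonneg (sub_nonneg.2 hv.2)]
    ring_nf
  have e3 : Set.EqOn (fun v => Real.exp (-(|u - v| + |v|)))
      (fun v => Real.exp u * Real.exp (-2 * v)) (Set.Ioi u) := fun v hv => by
    have hv : u < v := hv
    simp only [← Real.exp_add, abs_of_pos (hu.trans_lt hv), abs_of_neg (sub_neg.2 hv)]
    ring_nf
  have i1 : IntegrableOn (fun v => Real.exp (-(|u - v| + |v|))) (Set.Iic 0) :=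
    IntegrableOn.congr_fun ((integrableOn_exp_mul_Iic two_pos 0).const_mul _) e1.symm
      measurableSet_Iic
  have i3 : IntegrableOn (fun v => Real.exp (-(|u - v| + |v|))) (Set.Ioi u) :=
    IntegrableOn.congr_fun ((integrableOn_exp_mul_Ioi (by norm_num) u).const_mul _) e3.symm
      measurableSet_Ioi
  have i2 : IntervalIntegrable (fun v => Real.exp (-(|u - v| + |v|))) volume 0 u :=
    Continuous.intervalIntegrable (by fun_prop) _ _
  have i23 : IntegrableOn (fun v => Real.exp (-(|u - v| + |v|))) (Set.Ioi 0) := by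
    rw [← Set.Ioc_union_Ioi_eq_Ioi hu]
    exact ((intervalIntegrable_iff_integrableOn_Ioc_of_le hu).1 i2).union i3
  rw [← intervalIntegral.integral_Iic_add_Ioi i1 i23,
    ← intervalIntegral.integral_interval_add_Ioi' i2 i3,
    setIntegral_congr_fun measurableSet_Iic e1, setIntegral_congr_fun measurableSet_Ioi e3,
    intervalIntegral.integral_congr e2, integral_const_mul, integral_const_mul,
    integral_exp_mul_Iic two_pos, integral_exp_mul_Ioi (by norm_num)]
  have h : Real.exp u * Real.exp (-2 * u) = Real.exp (-u) := by
    rw [← Real.exp_add]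
    ring_nf
  simp only [intervalIntegral.integral_const, smul_eq_mul, sub_zero, mul_zero, Real.exp_zero]
  linear_combination (1 / 2) * h

theorem integral_exp_neg_abs_sub_add_abs (u : ℝ) :
    ∫ v, Real.exp (-(|u - v| + |v|)) = (1 + |u|) * Real.exp (-|u|) := by
  rcases le_total 0 u with hu | hu
  · rw [integral_exp_neg_abs_sub_add_abs_of_nonneg hu, abs_of_nonneg hu]
  · rw [← integral_neg_eq_self, abs_of_nonpos hu,
      ← integral_exp_neg_abs_sub_add_abs_of_nonneg (neg_nonneg.2 hu)]
    congr 1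
    ext v
    rw [abs_neg v, ← abs_neg (u - -v)]
    ring_nf

theorem integral_one_add_mul_exp_neg_two_mul_Ioi :
    ∫ u in Set.Ioi (0 : ℝ), (1 + u) * Real.exp (-(2 * u)) = 3 / 4 := by
  have hd : ∀ u ∈ Set.Ici (0 : ℝ), HasDerivAt (fun u => -((3 / 4 + u / 2) * Real.exp (-(2 * u))))
      ((1 + u) * Real.exp (-(2 * u))) u := fun u _ => by
    have h1 : HasDerivAt (fun u : ℝ => 3 / 4 + u / 2) (1 / 2) u :=
      ((hasDerivAt_id u).div_const 2).const_add _
    have h2 : HasDerivAt (fun u : ℝ => -(2 * u)) (-(2 * 1)) u :=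
      ((hasDerivAt_id u).const_mul 2).neg
    convert! (h1.mul h2.exp).neg using 1
    ring
  have ht : Filter.Tendsto (fun u : ℝ => -((3 / 4 + u / 2) * Real.exp (-(2 * u)))) Filter.atTop
      (nhds 0) := by
    have h2 : Filter.Tendsto (fun u : ℝ => 2 * u) Filter.atTop Filter.atTop :=
      Filter.tendsto_id.const_mul_atTop two_pos
    have h0 := (Real.tendsto_pow_mul_exp_neg_atTop_nhds_zero 0).comp h2
    have h1 := (Real.tendsto_pow_mul_exp_neg_atTop_nhds_zero 1).comp h2
    have h := ((h0.const_mul (3 / 4)).add (h1.const_mul (1 / 4))).neg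
    simp only [mul_zero, add_zero, neg_zero] at h
    refine h.congr fun u => ?_
    simp only [Function.comp_apply]
    ring
  rw [integral_Ioi_of_hasDerivAt_of_nonneg' hd
    (fun u hu => mul_nonneg (by linarith [Set.mem_Ioi.1 hu]) (Real.exp_pos _).le) ht]
  norm_num

theorem integral_triangleWeight : ∫ p, triangleWeight p = 3 / 2 := by
  have h := integral_prod triangleWeight integrable_triangleWeight
  rw [← Measure.volume_eq_prod] at h
  have h' : ∀ u : ℝ, ∫ v, triangleWeight (u, v) = (1 + |u|) * Real.exp (-(2 * |u|)) := fun u => by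
    have : ∀ v : ℝ, triangleWeight (u, v) = Real.exp (-|u|) * Real.exp (-(|u - v| + |v|)) :=
      fun v => by
        rw [triangleWeight, ← Real.exp_add]
        ring_nf
    simp_rw [this]
    rw [integral_const_mul, integral_exp_neg_abs_sub_add_abs, mul_left_comm, ← Real.exp_add]
    ring_nf
  simp_rw [h'] at h
  rw [h, integral_comp_abs (f := fun u => (1 + u) * Real.exp (-(2 * u))),
    integral_one_add_mul_exp_neg_two_mul_Ioi]
  norm_num

theorem integral_eq_inv_mul_integral_rescaled {κ : ℝ} (hκ : 0 < κ) (G : ℝ → ℝ) (x : ℝ) :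
    ∫ y, G y = κ⁻¹ * ∫ u, G (x + κ⁻¹ * u) := by
  rw [Measure.integral_comp_mul_left (fun t => G (x + t)) κ⁻¹, integral_add_left_eq_self G x,
    inv_inv, abs_of_pos hκ, smul_eq_mul, ← mul_assoc, inv_mul_cancel₀ hκ.ne', one_mul]

theorem quadKernel_eq_integral_triangleWeight {κ A B : ℝ} (hκ : 0 < κ) {V h : ℝ → ℝ}
    (hV : Continuous V) (hh : Continuous h) (hA : ∀ x, |V x| ≤ A) (hB : ∀ x, |h x| ≤ B) (x : ℝ) :
    16 * κ ^ 5 * quadKernel κ V h x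
      = 2 * ∫ p, triangleWeight p * (V (x + κ⁻¹ * p.1) * h (x + κ⁻¹ * p.2)) := by
  have hA0 : 0 ≤ A := (abs_nonneg _).trans (hA 0)
  have hF : Integrable fun p : ℝ × ℝ =>
      triangleWeight p * (V (x + κ⁻¹ * p.1) * h (x + κ⁻¹ * p.2)) :=
    integrable_triangleWeight.mul_bdd (c := A * B) (Continuous.aestronglyMeasurable (by fun_prop))
      (Filter.Eventually.of_forall fun p => by
        rw [Real.norm_eq_abs, abs_mul]
        exact mul_le_mul (hA _) (hB _) (abs_nonneg _) hA0)
  have hp := integral_prod _ hF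
  rw [← Measure.volume_eq_prod] at hp
  have hk : ∀ t s : ℝ, t = κ⁻¹ * s → κ * |t| = |s| := fun t s hts => by
    rw [hts, abs_mul, abs_of_pos (inv_pos.2 hκ), mul_inv_cancel_left₀ hκ.ne']
  have hpt : ∀ u v : ℝ,
      freeKernel κ x (x + κ⁻¹ * u) * V (x + κ⁻¹ * u) * freeKernel κ (x + κ⁻¹ * u) (x + κ⁻¹ * v)
        * h (x + κ⁻¹ * v) * freeKernel κ (x + κ⁻¹ * v) x
      = (2 * κ)⁻¹ ^ 3 *
        (triangleWeight (u, v) * (V (x + κ⁻¹ * u) * h (x + κ⁻¹ * v))) := fun u v => by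
    have k1 : κ * |x - (x + κ⁻¹ * u)| = |u| := by
      rw [← abs_neg u]
      exact hk _ _ (by ring)
    have k2 : κ * |x + κ⁻¹ * u - (x + κ⁻¹ * v)| = |u - v| := hk _ _ (by ring)
    have k3 : κ * |x + κ⁻¹ * v - x| = |v| := hk _ _ (by ring)
    have : triangleWeight (u, v) = Real.exp (-|u|) * Real.exp (-|u - v|) * Real.exp (-|v|) := by
      rw [triangleWeight, ← Real.exp_add, ← Real.exp_add]
      ring_nf
    rw [freeKernel, freeKernel, freeKernel, k1, k2, k3, this]
    ring
  have hq : quadKernel κ V h x = κ⁻¹ * (κ⁻¹ * ((2 * κ)⁻¹ ^ 3 *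
      ∫ p, triangleWeight p * (V (x + κ⁻¹ * p.1) * h (x + κ⁻¹ * p.2)))) := by
    have hin : ∀ u : ℝ, ∫ z, freeKernel κ x (x + κ⁻¹ * u) * V (x + κ⁻¹ * u)
        * freeKernel κ (x + κ⁻¹ * u) z * h z * freeKernel κ z x
        = κ⁻¹ * ((2 * κ)⁻¹ ^ 3 *
          ∫ v, triangleWeight (u, v) * (V (x + κ⁻¹ * u) * h (x + κ⁻¹ * v))) := fun u => by
      rw [integral_eq_inv_mul_integral_rescaled hκ _ x]
      simp_rw [hpt]
      rw [integral_const_mul]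
    rw [quadKernel, integral_eq_inv_mul_integral_rescaled hκ _ x]
    simp_rw [hin]
    rw [integral_const_mul, integral_const_mul, hp]
  rw [hq]
  field_simp
  ring

theorem integral_mul_rescaled_sub_eq {A : ℝ} {V : ℝ → ℝ} (hV : Continuous V) (hA : ∀ x, |V x| ≤ A)
    (φ h : SchwartzMap ℝ ℝ) (ε : ℝ) :
    Integrable (fun p => triangleWeight p * pairedIncrement φ V h (ε * p.1) (ε * p.2)) ∧
    ∫ x, φ x * ((2 * ∫ p, triangleWeight p * (V (x + ε * p.1) * h (x + ε * p.2))) - 3 * V x * h x)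
      = 2 * ∫ p, triangleWeight p * pairedIncrement φ V h (ε * p.1) (ε * p.2) := by
  obtain ⟨B, hB⟩ : ∃ B, ∀ x, |h x| ≤ B := ⟨_, h.norm_le_seminorm ℝ⟩
  have hA0 : 0 ≤ A := (abs_nonneg _).trans (hA 0)
  have hVh : ∀ x y, |V x * h y| ≤ A * B := fun x y => by
    rw [abs_mul]
    exact mul_le_mul (hA x) (hB y) (abs_nonneg _) hA0
  have hF : Integrable (Function.uncurry fun (x : ℝ) (p : ℝ × ℝ) => φ x * triangleWeight p *
      (V (x + ε * p.1) * h (x + ε * p.2) - V x * h x)) (volume.prod volume) := by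
    refine (φ.integrable.mul_prod integrable_triangleWeight).mul_bdd (c := A * B + A * B)
      (Continuous.aestronglyMeasurable (by fun_prop)) (Filter.Eventually.of_forall fun z => ?_)
    rw [Real.norm_eq_abs]
    exact (abs_sub _ _).trans (add_le_add (hVh _ _) (hVh _ _))
  have hinner : ∀ p : ℝ × ℝ, ∫ x, φ x * triangleWeight p *
      (V (x + ε * p.1) * h (x + ε * p.2) - V x * h x)
      = triangleWeight p * pairedIncrement φ V h (ε * p.1) (ε * p.2) := fun p => by
    rw [pairedIncrement, ← integral_const_mul]
    congr 1
    ext x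
    ring
  refine ⟨?_, ?_⟩
  · refine hF.integral_prod_right.congr (Filter.Eventually.of_forall fun p => ?_)
    exact hinner p
  · simp_rw [← hinner]
    rw [← integral_integral_swap hF, ← integral_const_mul]
    congr 1
    ext x
    have hi : Integrable fun p : ℝ × ℝ =>
        triangleWeight p * (V (x + ε * p.1) * h (x + ε * p.2)) :=
      integrable_triangleWeight.mul_bdd (c := A * B) (Continuous.aestronglyMeasurable (by fun_prop))
        (Filter.Eventually.of_forall fun p => hVh _ _)
    simp_rw [mul_assoc (φ x), mul_sub (triangleWeight _)]
    rw [integral_const_mul, integral_sub hi (integrable_triangleWeight.mul_const _),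
      integral_mul_const, integral_triangleWeight]
    ring

theorem abs_two_mul_integral_triangleWeight_le {D : ℝ → ℝ → ℝ} {ε L : ℝ}
    (hD : Integrable fun p : ℝ × ℝ => triangleWeight p * D (ε * p.1) (ε * p.2))
    (hL : ∀ a b, |D a b + D (-a) (-b)| ≤ (2 * a ^ 2 + 2 * (|a| * |b|) + b ^ 2) * L) :
    |2 * ∫ p : ℝ × ℝ, triangleWeight p * D (ε * p.1) (ε * p.2)|
      ≤ (∫ p : ℝ × ℝ, triangleWeight p * (2 * p.1 ^ 2 + 2 * (|p.1| * |p.2|) + p.2 ^ 2))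
        * (ε ^ 2 * L) := by
  have hneg : ∫ p : ℝ × ℝ, triangleWeight p * D (ε * p.1) (ε * p.2)
      = ∫ p : ℝ × ℝ, triangleWeight p * D (-(ε * p.1)) (-(ε * p.2)) := by
    rw [← integral_neg_eq_self]
    simp only [triangleWeight_neg, Prod.fst_neg, Prod.snd_neg, mul_neg]
  have hD' : Integrable fun p : ℝ × ℝ => triangleWeight p * D (-(ε * p.1)) (-(ε * p.2)) := by
    have := hD.comp_neg
    simpa only [triangleWeight_neg, Prod.fst_neg, Prod.snd_neg, mul_neg] using this
  have hsum : 2 * ∫ p : ℝ × ℝ, triangleWeight p * D (ε * p.1) (ε * p.2)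
      = ∫ p : ℝ × ℝ, triangleWeight p *
        (D (ε * p.1) (ε * p.2) + D (-(ε * p.1)) (-(ε * p.2))) := by
    simp_rw [mul_add]
    rw [integral_add hD hD', ← hneg, two_mul]
  rw [hsum, ← integral_mul_const, ← Real.norm_eq_abs]
  refine norm_integral_le_of_norm_le (integrable_triangleWeight_mul_quadratic.mul_const _)
    (Filter.Eventually.of_forall fun p => ?_)
  rw [Real.norm_eq_abs, abs_mul, abs_of_nonneg (triangleWeight_nonneg p), mul_assoc]
  refine mul_le_mul_of_nonneg_left ((hL _ _).trans (le_of_eq ?_)) (triangleWeight_nonneg p)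
  rw [abs_mul, abs_mul, mul_pow, mul_pow, ← sq_abs ε]
  ring

theorem l2norm_le_sqrt_integral {f g : ℝ → ℝ} (hg : Integrable g) (h : ∀ x, f x ^ 2 ≤ g x) :
    l2norm f ≤ Real.sqrt (∫ x, g x) :=
  Real.sqrt_le_sqrt (integral_mono_of_nonneg (Filter.Eventually.of_forall fun _ => sq_nonneg _) hg
    (Filter.Eventually.of_forall h))

/-- The mixed background-perturbation quadratic term of the `H_κ` flow converges to
`3Vq'` at rate `κ⁻²`: for `V` twice continuously differentiable with `V, V', V''` bounded,
`|∫ φ (16κ⁵ T_κ(V,q') − 3Vq')| ≤ C κ⁻² ‖φ‖_{H¹} (‖V‖_∞+‖V'‖_∞+‖V''‖_∞) ‖q‖_{H²}`. -/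
theorem mixed_quadratic_term_convergence :
    ∃ C > 0, ∀ κ : ℝ, 1 ≤ κ → ∀ V : ℝ → ℝ, ContDiff ℝ 2 V →
      (∃ M : ℝ, ∀ x : ℝ, |V x| ≤ M ∧ |deriv V x| ≤ M ∧ |deriv (deriv V) x| ≤ M) →
      ∀ q φ : SchwartzMap ℝ ℝ,
        |∫ x : ℝ, φ x * (16 * κ ^ 5 * quadKernel κ V (deriv (q : ℝ → ℝ)) x
            - 3 * V x * deriv (q : ℝ → ℝ) x)|
          ≤ C * κ⁻¹ ^ 2 * H1norm (φ : ℝ → ℝ)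
              * ((⨆ x : ℝ, |V x|) + (⨆ x : ℝ, |deriv V x|) + (⨆ x : ℝ, |deriv (deriv V) x|))
              * H2norm (q : ℝ → ℝ) := by
  set K := ∫ p : ℝ × ℝ, triangleWeight p * (2 * p.1 ^ 2 + 2 * (|p.1| * |p.2|) + p.2 ^ 2) with hK
  have hK0 : 0 ≤ K := integral_nonneg fun p => mul_nonneg (triangleWeight_nonneg p) (by positivity)
  refine ⟨K + 1, by positivity, fun κ hκ V hV hM q φ => ?_⟩
  obtain ⟨M, hM⟩ := hM
  have hκ0 : 0 < κ := one_pos.trans_le hκ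
  have hV₁ : ContDiff ℝ 1 (deriv V) := ContDiff.deriv' (n := 1) (by simpa using! hV)
  have hd₀ : ∀ x, HasDerivAt V (deriv V x) x := fun x =>
    (hV.differentiable (by norm_num) x).hasDerivAt
  have hd₁ : ∀ x, HasDerivAt (deriv V) (deriv (deriv V) x) x := fun x =>
    (hV₁.differentiable (by norm_num) x).hasDerivAt
  have hsup : ∀ f : ℝ → ℝ, (∀ x, |f x| ≤ M) → ∀ x, |f x| ≤ ⨆ x, |f x| := fun f hf x =>
    le_ciSup (f := fun x => |f x|) ⟨M, Set.forall_mem_range.2 hf⟩ x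
  have hM₀ := hsup V fun x => (hM x).1
  have hM₁ := hsup (deriv V) fun x => (hM x).2.1
  have hM₂ := hsup (deriv (deriv V)) fun x => (hM x).2.2
  set h : SchwartzMap ℝ ℝ := SchwartzMap.derivCLM ℝ ℝ q with hh
  have hcoe : deriv (q : ℝ → ℝ) = h := rfl
  have hφ : Integrable fun x => φ x ^ 2 + deriv φ x ^ 2 :=
    (φ.memLp 2).integrable_sq.add φ.memLp_deriv_two.integrable_sq
  have hq : Integrable fun x => q x ^ 2 + deriv q x ^ 2 + iteratedDeriv 2 q x ^ 2 := by
    have h₂ : iteratedDeriv 2 (q : ℝ → ℝ) = deriv h := by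
      rw [iteratedDeriv_succ, iteratedDeriv_one, hcoe]
    rw [h₂]
    exact ((q.memLp 2).integrable_sq.add q.memLp_deriv_two.integrable_sq).add
      h.memLp_deriv_two.integrable_sq
  have hφ₀ : l2norm φ ≤ H1norm φ := l2norm_le_sqrt_integral hφ fun x => by
    linarith [sq_nonneg (deriv φ x)]
  have hφ₁ : l2norm (deriv φ) ≤ H1norm φ := l2norm_le_sqrt_integral hφ fun x => by
    linarith [sq_nonneg (φ x)]
  have hh₀ : l2norm h ≤ H2norm q := l2norm_le_sqrt_integral hq fun x => by
    rw [← hcoe]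
    linarith [sq_nonneg (q x), sq_nonneg (iteratedDeriv 2 q x)]
  have hh₁ : l2norm (deriv h) ≤ H2norm q := l2norm_le_sqrt_integral hq fun x => by
    rw [← hcoe, iteratedDeriv_succ, iteratedDeriv_one]
    linarith [sq_nonneg (q x), sq_nonneg (deriv q x)]
  obtain ⟨B, hB⟩ : ∃ B, ∀ x, |h x| ≤ B := ⟨_, h.norm_le_seminorm ℝ⟩
  obtain ⟨hF, heq⟩ := integral_mul_rescaled_sub_eq hV.continuous hM₀ φ h κ⁻¹
  have hbound := abs_two_mul_integral_triangleWeight_le hF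
    (abs_pairedIncrement_add_neg_le hd₀ hd₁ hM₀ hM₁ hM₂ φ h hφ₀ hφ₁ hh₀ hh₁)
  rw [hcoe]
  simp_rw [quadKernel_eq_integral_triangleWeight hκ0 hV.continuous h.continuous hM₀ hB]
  rw [heq]
  have hS : 0 ≤ (⨆ x, |V x|) + (⨆ x, |deriv V x|) + (⨆ x, |deriv (deriv V) x|) :=
    add_nonneg (add_nonneg ((abs_nonneg _).trans (hM₀ 0)) ((abs_nonneg _).trans (hM₁ 0)))
      ((abs_nonneg _).trans (hM₂ 0))
  have hP : 0 ≤ κ⁻¹ ^ 2 * (H1norm φ * ((⨆ x, |V x|) + (⨆ x, |deriv V x|)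
      + (⨆ x, |deriv (deriv V) x|)) * H2norm q) :=
    mul_nonneg (sq_nonneg _) (mul_nonneg (mul_nonneg (Real.sqrt_nonneg _) hS) (Real.sqrt_nonneg _))
  refine hbound.trans ?_
  rw [← hK]
  linarith
end

section
/- Let T > 0, let V : [−T,T] × ℝ → ℝ be jointly continuous with jointly continuous spatial derivative ∂ₓV, with V and ∂ₓV bounded, and let q and q̃ both be regular solutions on [−T,T] of ∂ₜq = −∂ₓ³q + 6 q ∂ₓq + 6 ∂ₓ(V q) with the same potential V. Then t ↦ (1/2)∫_ℝ (q(t,x) − q̃(t,x))² dx is differentiable on [−T,T] and d/dt (1/2)∫_ℝ (q − q̃)² dx = ∫_ℝ (q − q̃)² · ( (3/2) ∂ₓ(q + q̃) + 3 ∂ₓV ) dx. -/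
open MeasureTheory

/-- `q : [−T,T] × ℝ → ℝ` is a regular solution of KdV with potential `V`,
`∂ₜq = −∂ₓ³q + 6 q ∂ₓq + 6 ∂ₓ(V q)`: the time derivative exists on the slab, `q`
and its derivatives `∂ₜq, ∂ₓq, ∂ₓ²q, ∂ₓ³q` are jointly continuous on the slab,
`q(t,·)` is Schwartz for each `t` with Schwartz seminorms bounded uniformly in `t`,
and the equation holds pointwise. -/
def IsRegularSolution (T : ℝ) (V q : ℝ → ℝ → ℝ) : Prop :=
  (∀ x : ℝ, ∀ t ∈ Set.Icc (-T) T, DifferentiableAt ℝ (fun s => q s x) t) ∧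
  ContinuousOn (fun p : ℝ × ℝ => q p.1 p.2) (Set.Icc (-T) T ×ˢ Set.univ) ∧
  ContinuousOn (fun p : ℝ × ℝ => deriv (fun s => q s p.2) p.1) (Set.Icc (-T) T ×ˢ Set.univ) ∧
  ContinuousOn (fun p : ℝ × ℝ => deriv (q p.1) p.2) (Set.Icc (-T) T ×ˢ Set.univ) ∧
  ContinuousOn (fun p : ℝ × ℝ => iteratedDeriv 2 (q p.1) p.2) (Set.Icc (-T) T ×ˢ Set.univ) ∧
  ContinuousOn (fun p : ℝ × ℝ => iteratedDeriv 3 (q p.1) p.2) (Set.Icc (-T) T ×ˢ Set.univ) ∧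
  (∀ t ∈ Set.Icc (-T) T, ContDiff ℝ (⊤ : ℕ∞) (q t)) ∧
  (∀ k n : ℕ, ∃ M : ℝ, ∀ t ∈ Set.Icc (-T) T, ∀ x : ℝ,
      |x| ^ k * |iteratedDeriv n (q t) x| ≤ M) ∧
  (∀ t ∈ Set.Icc (-T) T, ∀ x : ℝ,
      deriv (fun s => q s x) t =
        -(iteratedDeriv 3 (q t) x) + 6 * q t x * deriv (q t) x
          + 6 * deriv (fun y => V t y * q t y) x)

/-- Differentiation under the integral sign within a convex set of parameters. -/
theorem hasDerivWithinAt_integral_of_dominated {α E : Type*} [MeasurableSpace α]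
    [NormedAddCommGroup E] [NormedSpace ℝ E] {μ : Measure α} {s : Set ℝ} (hs : Convex ℝ s)
    {F F' : ℝ → α → E} {bound : α → ℝ} (hF : ∀ t ∈ s, Integrable (F t) μ)
    (hbound : Integrable bound μ)
    (hderiv : ∀ x, ∀ t ∈ s, HasDerivWithinAt (fun r => F r x) (F' t x) s t)
    (hle : ∀ x, ∀ t ∈ s, ‖F' t x‖ ≤ bound x) {t : ℝ} (ht : t ∈ s) :
    HasDerivWithinAt (fun r => ∫ x, F r x ∂μ) (∫ x, F' t x ∂μ) s t := by
  rw [hasDerivWithinAt_iff_tendsto_slope]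
  have hmem : ∀ᶠ r in nhdsWithin t (s \ {t}), r ∈ s \ {t} := self_mem_nhdsWithin
  have hlim : Filter.Tendsto (fun r => ∫ x, slope (fun u => F u x) t r ∂μ)
      (nhdsWithin t (s \ {t})) (nhds (∫ x, F' t x ∂μ)) := by
    refine tendsto_integral_filter_of_dominated_convergence bound ?_ ?_ hbound ?_
    · filter_upwards [hmem] with r hr
      exact (((hF r hr.1).sub (hF t ht)).smul (r - t)⁻¹).aestronglyMeasurable
    · filter_upwards [hmem] with r hr
      refine Filter.Eventually.of_forall fun x => ?_
      have h := hs.norm_image_sub_le_of_norm_hasDerivWithin_le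
        (hderiv x) (hle x) ht hr.1
      have hpos : 0 < ‖r - t‖ := norm_pos_iff.2 (sub_ne_zero.2 hr.2)
      rw [slope_def_module, norm_smul, norm_inv, inv_mul_le_iff₀ hpos, mul_comm]
      exact h
    · exact Filter.Eventually.of_forall fun x =>
        hasDerivWithinAt_iff_tendsto_slope.1 (hderiv x t ht)
  refine hlim.congr' ?_
  filter_upwards [hmem] with r hr
  simp only [slope_def_module]
  rw [integral_smul, integral_sub (hF r hr.1) (hF t ht)]

/-- A continuous function with quadratic decay times a bounded continuous function is
integrable. -/
theorem integrable_mul_of_decay {f g : ℝ → ℝ} (hf : Continuous f) (hg : Continuous g)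
    {C D : ℝ} (hfC : ∀ x, |f x| ≤ C * (1 + x ^ 2)⁻¹) (hgD : ∀ x, |g x| ≤ D) :
    Integrable (fun x => f x * g x) := by
  have hfi : Integrable f :=
    (integrable_inv_one_add_sq.const_mul C).mono' hf.aestronglyMeasurable
      (Filter.Eventually.of_forall hfC)
  exact hfi.mul_bdd (c := D) hg.aestronglyMeasurable (Filter.Eventually.of_forall hgD)

namespace IsRegularSolution

variable {T : ℝ} {V q : ℝ → ℝ → ℝ}

/-- Uniform quadratic decay of every spatial derivative. -/
theorem exists_decay (hq : IsRegularSolution T V q) (n : ℕ) :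
    ∃ C : ℝ, 0 ≤ C ∧ ∀ t ∈ Set.Icc (-T) T, ∀ x : ℝ,
      |iteratedDeriv n (q t) x| ≤ C * (1 + x ^ 2)⁻¹ := by
  obtain ⟨-, -, -, -, -, -, -, hM, -⟩ := hq
  obtain ⟨A, hA⟩ := hM 0 n
  obtain ⟨B, hB⟩ := hM 2 n
  refine ⟨max 0 (A + B), le_max_left _ _, fun t ht x => ?_⟩
  have h0 := hA t ht x
  have h2 := hB t ht x
  rw [sq_abs] at h2
  rw [← div_eq_mul_inv, le_div_iff₀ (by positivity)]
  refine le_trans ?_ (le_max_right _ _)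
  linarith

/-- Uniform bound of every spatial derivative. -/
theorem exists_bound (hq : IsRegularSolution T V q) (n : ℕ) :
    ∃ C : ℝ, ∀ t ∈ Set.Icc (-T) T, ∀ x : ℝ, |iteratedDeriv n (q t) x| ≤ C := by
  obtain ⟨C, hC, h⟩ := hq.exists_decay n
  refine ⟨C, fun t ht x => (h t ht x).trans (mul_le_of_le_one_right hC ?_)⟩
  exact inv_le_one_of_one_le₀ (by nlinarith [sq_nonneg x])

theorem contDiff (hq : IsRegularSolution T V q) {t : ℝ} (ht : t ∈ Set.Icc (-T) T) :
    ContDiff ℝ (⊤ : ℕ∞) (q t) :=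
  hq.2.2.2.2.2.2.1 t ht

theorem continuous_iteratedDeriv (hq : IsRegularSolution T V q) {t : ℝ}
    (ht : t ∈ Set.Icc (-T) T) (n : ℕ) : Continuous (iteratedDeriv n (q t)) :=
  (hq.contDiff ht).continuous_iteratedDeriv n (by exact_mod_cast le_top)

theorem hasDerivAt_iteratedDeriv (hq : IsRegularSolution T V q) {t : ℝ}
    (ht : t ∈ Set.Icc (-T) T) (n : ℕ) (x : ℝ) :
    HasDerivAt (iteratedDeriv n (q t)) (iteratedDeriv (n + 1) (q t) x) x := by
  rw [iteratedDeriv_succ]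
  exact ((hq.contDiff ht).differentiable_iteratedDeriv n
    (by exact_mod_cast ENat.natCast_lt_top n) x).hasDerivAt

/-- The equation with the derivative of `V q` expanded and all spatial derivatives iterated. -/
theorem hasDerivAt_time (hq : IsRegularSolution T V q)
    (hV : ∀ t ∈ Set.Icc (-T) T, Differentiable ℝ (V t)) {t : ℝ} (ht : t ∈ Set.Icc (-T) T)
    (x : ℝ) :
    HasDerivAt (fun s => q s x)
      (-(iteratedDeriv 3 (q t) x) + 6 * q t x * iteratedDeriv 1 (q t) x
        + 6 * (deriv (V t) x * q t x + V t x * iteratedDeriv 1 (q t) x)) t := by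
  have h := (hq.1 x t ht).hasDerivAt
  have h0 := hq.hasDerivAt_iteratedDeriv ht 0 x
  rw [iteratedDeriv_zero] at h0
  have hVq : deriv (fun y => V t y * q t y) x
      = deriv (V t) x * q t x + V t x * iteratedDeriv 1 (q t) x :=
    ((hV t ht x).hasDerivAt.mul h0).deriv
  rw [hq.2.2.2.2.2.2.2.2 t ht x, hVq] at h
  rwa [iteratedDeriv_one] at h ⊢

end IsRegularSolution

/-- `L²` energy identity for the difference of two regular solutions of KdV with
potential `V`: `d/dt (1/2)∫ (q−q̃)² dx = ∫ (q−q̃)² ((3/2)∂ₓ(q+q̃) + 3∂ₓV) dx`. -/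
theorem difference_energy_identity (T : ℝ) (hT : 0 < T) (V q qt : ℝ → ℝ → ℝ)
    (hVc : ContinuousOn (fun p : ℝ × ℝ => V p.1 p.2) (Set.Icc (-T) T ×ˢ Set.univ))
    (hVx : ∀ t ∈ Set.Icc (-T) T, Differentiable ℝ (V t))
    (hVxc : ContinuousOn (fun p : ℝ × ℝ => deriv (V p.1) p.2) (Set.Icc (-T) T ×ˢ Set.univ))
    (hVbdd : ∃ M : ℝ, ∀ t ∈ Set.Icc (-T) T, ∀ x : ℝ, |V t x| ≤ M ∧ |deriv (V t) x| ≤ M)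
    (hq : IsRegularSolution T V q) (hqt : IsRegularSolution T V qt) :
    ∀ t ∈ Set.Icc (-T) T,
      HasDerivWithinAt (fun s => (1 / 2) * ∫ x : ℝ, (q s x - qt s x) ^ 2)
        (∫ x : ℝ, (q t x - qt t x) ^ 2
            * ((3 / 2) * (deriv (q t) x + deriv (qt t) x) + 3 * deriv (V t) x))
        (Set.Icc (-T) T) t := by
  obtain ⟨M, hM⟩ := hVbdd
  -- the spatial derivatives of the difference, their sum, and the time derivative
  set w : ℕ → ℝ → ℝ → ℝ := fun n t x => iteratedDeriv n (q t) x - iteratedDeriv n (qt t) x with hw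
  set S : ℕ → ℝ → ℝ → ℝ := fun n t x => iteratedDeriv n (q t) x + iteratedDeriv n (qt t) x with hS
  set W : ℝ → ℝ → ℝ := fun t x => -w 3 t x + 3 * S 1 t x * w 0 t x + 3 * S 0 t x * w 1 t x
    + 6 * (deriv (V t) x * w 0 t x + V t x * w 1 t x) with hW
  have hw_cont : ∀ n, ∀ t ∈ Set.Icc (-T) T, Continuous (w n t) := fun n t ht =>
    (hq.continuous_iteratedDeriv ht n).sub (hqt.continuous_iteratedDeriv ht n)
  have hS_cont : ∀ n, ∀ t ∈ Set.Icc (-T) T, Continuous (S n t) := fun n t ht =>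
    (hq.continuous_iteratedDeriv ht n).add (hqt.continuous_iteratedDeriv ht n)
  have hw_deriv : ∀ n, ∀ t ∈ Set.Icc (-T) T, ∀ x, HasDerivAt (w n t) (w (n + 1) t x) x :=
    fun n t ht x => (hq.hasDerivAt_iteratedDeriv ht n x).sub (hqt.hasDerivAt_iteratedDeriv ht n x)
  have hS_deriv : ∀ n, ∀ t ∈ Set.Icc (-T) T, ∀ x, HasDerivAt (S n t) (S (n + 1) t x) x :=
    fun n t ht x => (hq.hasDerivAt_iteratedDeriv ht n x).add (hqt.hasDerivAt_iteratedDeriv ht n x)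
  have hw_decay : ∀ n, ∃ C, ∀ t ∈ Set.Icc (-T) T, ∀ x,
      |w n t x| ≤ C * (1 + x ^ 2)⁻¹ := fun n => by
    obtain ⟨A, -, hA⟩ := hq.exists_decay n
    obtain ⟨B, -, hB⟩ := hqt.exists_decay n
    refine ⟨A + B, fun t ht x => (abs_sub _ _).trans ?_⟩
    rw [add_mul]
    exact add_le_add (hA t ht x) (hB t ht x)
  have hw_bound : ∀ n, ∃ C, ∀ t ∈ Set.Icc (-T) T, ∀ x, |w n t x| ≤ C := fun n => by
    obtain ⟨A, hA⟩ := hq.exists_bound n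
    obtain ⟨B, hB⟩ := hqt.exists_bound n
    exact ⟨A + B, fun t ht x => (abs_sub _ _).trans (add_le_add (hA t ht x) (hB t ht x))⟩
  have hS_bound : ∀ n, ∃ C, ∀ t ∈ Set.Icc (-T) T, ∀ x, |S n t x| ≤ C := fun n => by
    obtain ⟨A, hA⟩ := hq.exists_bound n
    obtain ⟨B, hB⟩ := hqt.exists_bound n
    exact ⟨A + B, fun t ht x => (abs_add_le _ _).trans (add_le_add (hA t ht x) (hB t ht x))⟩
  have hV_cont : ∀ t ∈ Set.Icc (-T) T, Continuous (V t) := fun t ht => (hVx t ht).continuous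
  have hV'_cont : ∀ t ∈ Set.Icc (-T) T, Continuous (deriv (V t)) := fun t ht =>
    hVxc.comp_continuous (f := fun x : ℝ => (t, x)) (by fun_prop) fun x => ⟨ht, trivial⟩
  have hW_cont : ∀ t ∈ Set.Icc (-T) T, Continuous (W t) := fun t ht => by
    have := hw_cont 0 t ht
    have := hw_cont 1 t ht
    have := hw_cont 3 t ht
    have := hS_cont 0 t ht
    have := hS_cont 1 t ht
    have := hV_cont t ht
    have := hV'_cont t ht
    simp only [hW]
    fun_prop
  obtain ⟨A, hA⟩ := hw_decay 0
  obtain ⟨B, hB⟩ := hw_decay 1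
  obtain ⟨C₀, hC₀⟩ := hw_bound 0
  obtain ⟨C₁, hC₁⟩ := hw_bound 1
  obtain ⟨C₂, hC₂⟩ := hw_bound 2
  obtain ⟨C₃, hC₃⟩ := hw_bound 3
  obtain ⟨D₀, hD₀⟩ := hS_bound 0
  obtain ⟨D₁, hD₁⟩ := hS_bound 1
  have habs_mul : ∀ {a b c d : ℝ}, |a| ≤ c → |b| ≤ d → |a * b| ≤ c * d := fun ha hb => by
    rw [abs_mul]
    exact mul_le_mul ha hb (abs_nonneg _) ((abs_nonneg _).trans ha)
  obtain ⟨K, hK⟩ : ∃ K, ∀ t ∈ Set.Icc (-T) T, ∀ x, |W t x| ≤ K := by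
    refine ⟨C₃ + 3 * (D₁ * C₀) + 3 * (D₀ * C₁) + 6 * (M * C₀ + M * C₁), fun t ht x => ?_⟩
    have h3 := abs_le.1 (hC₃ t ht x)
    have h10 := abs_le.1 (habs_mul (hD₁ t ht x) (hC₀ t ht x))
    have h01 := abs_le.1 (habs_mul (hD₀ t ht x) (hC₁ t ht x))
    have hV0 := abs_le.1 (habs_mul (hM t ht x).2 (hC₀ t ht x))
    have hV1 := abs_le.1 (habs_mul (hM t ht x).1 (hC₁ t ht x))
    simp only [hW]
    rw [abs_le]
    constructor <;> linarith
  have hw_time : ∀ x, ∀ t ∈ Set.Icc (-T) T, HasDerivAt (fun s => w 0 s x) (W t x) t := by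
    intro x t ht
    have h := (hq.hasDerivAt_time hVx ht x).sub (hqt.hasDerivAt_time hVx ht x)
    simp only [hw, hW, hS, iteratedDeriv_zero]
    exact h.congr_deriv (by ring)
  intro t ht
  have hleib : HasDerivWithinAt (fun s => ∫ x, w 0 s x ^ 2) (∫ x, w 0 t x * (2 * W t x))
      (Set.Icc (-T) T) t := by
    refine hasDerivWithinAt_integral_of_dominated (convex_Icc _ _)
      (F' := fun t x => w 0 t x * (2 * W t x))
      (bound := fun x => A * (1 + x ^ 2)⁻¹ * (2 * K)) ?_
      ((integrable_inv_one_add_sq.const_mul A).mul_const _) ?_ ?_ ht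
    · intro t ht
      simp only [sq (w 0 t _)]
      exact integrable_mul_of_decay (hw_cont 0 t ht) (hw_cont 0 t ht) (hA t ht) (hC₀ t ht)
    · intro x t ht
      refine ((hw_time x t ht).pow 2).hasDerivWithinAt.congr_deriv ?_
      push_cast
      ring
    · intro x t ht
      refine habs_mul (hA t ht x) ?_
      rw [abs_mul, abs_two]
      exact mul_le_mul_of_nonneg_left (hK t ht x) zero_le_two
  have hint_W : Integrable (fun x => w 0 t x * W t x) :=
    integrable_mul_of_decay (hw_cont 0 t ht) (hW_cont t ht) (hA t ht) (hK t ht)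
  have hint_R : Integrable (fun x =>
      w 0 t x * (w 0 t x * ((3 / 2) * S 1 t x + 3 * deriv (V t) x))) := by
    refine integrable_mul_of_decay (D := C₀ * ((3 / 2) * D₁ + 3 * M)) (hw_cont 0 t ht) ?_
      (hA t ht) fun x => habs_mul (hC₀ t ht x) ?_
    · have := hw_cont 0 t ht
      have := hS_cont 1 t ht
      have := hV'_cont t ht
      fun_prop
    · have h1 := abs_le.1 (hD₁ t ht x)
      have h2 := abs_le.1 (hM t ht x).2
      rw [abs_le]
      constructor <;> linarith
  -- the flux whose spatial derivative is the difference of the two integrands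
  have hint_F : Integrable (fun x => w 0 t x * (-w 2 t x + (3 / 2) * (S 0 t x * w 0 t x)
      + 3 * (V t x * w 0 t x)) + w 1 t x * ((1 / 2) * w 1 t x)) := by
    have := hw_cont 0 t ht
    have := hw_cont 1 t ht
    have := hw_cont 2 t ht
    have := hS_cont 0 t ht
    have := hV_cont t ht
    refine (integrable_mul_of_decay (D := C₂ + (3 / 2) * (D₀ * C₀) + 3 * (M * C₀))
      (hw_cont 0 t ht) (by fun_prop) (hA t ht) fun x => ?_).add
      (integrable_mul_of_decay (D := (1 / 2) * C₁) (hw_cont 1 t ht) (by fun_prop)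
      (hB t ht) fun x => ?_)
    · have h2 := abs_le.1 (hC₂ t ht x)
      have h0 := abs_le.1 (habs_mul (hD₀ t ht x) (hC₀ t ht x))
      have hV0 := abs_le.1 (habs_mul (hM t ht x).1 (hC₀ t ht x))
      rw [abs_le]
      constructor <;> linarith
    · have h1 := abs_le.1 (hC₁ t ht x)
      rw [abs_le]
      constructor <;> linarith
  have hflux := integral_eq_zero_of_hasDerivAt_of_integrable (f' := fun x => w 0 t x * W t x -
      w 0 t x * (w 0 t x * ((3 / 2) * S 1 t x + 3 * deriv (V t) x))) (fun x => by
    have h0 := hw_deriv 0 t ht x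
    have h1 := hw_deriv 1 t ht x
    have h2 := hw_deriv 2 t ht x
    have hS0 := hS_deriv 0 t ht x
    have hV := (hVx t ht x).hasDerivAt
    refine ((h0.mul ((h2.neg.add ((hS0.mul h0).const_mul (3 / 2))).add
      ((hV.mul h0).const_mul 3))).add (h1.mul (h1.const_mul (1 / 2)))).congr_deriv ?_
    simp only [hW, Pi.add_apply, Pi.mul_apply, Pi.neg_apply]
    ring) (hint_W.sub hint_R) hint_F
  rw [integral_sub hint_W hint_R, sub_eq_zero] at hflux
  have hfinal := hleib.const_mul (1 / 2)
  simp only [hw, iteratedDeriv_zero] at hfinal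
  refine hfinal.congr_deriv ?_
  rw [← integral_const_mul]
  calc _ = ∫ x, w 0 t x * W t x := by
        congr 1
        ext x
        simp only [hw, iteratedDeriv_zero]
        ring
    _ = _ := by
        rw [hflux]
        congr 1
        ext x
        simp only [hw, hS, iteratedDeriv_zero, iteratedDeriv_one]
        ring
end
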